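/- Let 0 ≤ l < k ≤ n and let λ = (λ_1, …, λ_n) ∈ Γ_k with λ_1 ≥ λ_2 ≥ ⋯ ≥ λ_n and λ_n < 0. Then Σ_{i=1}^n [σ_{k−1}(λ|i)σ_l(λ) − σ_k(λ)σ_{l−1}(λ|i)] ≥ ((k−l)/k)·(1/C_n^l)·(−λ_n)^{k−l−1}·σ_l(λ)². Equivalently, Σ_{i=1}^n ∂[σ_k(λ)/σ_l(λ)]/∂λ_i ≥ ((k−l)/k)(1/C_n^l)(−λ_n)^{k−l−1}. (The eigenvalue estimate (2.13) established in the proof of Lemma 2.6.) -/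

import Mathlib

open Finset

noncomputable def esymm {n : ℕ} (lam : Fin n → ℝ) (m : ℤ) : ℝ :=
  if m < 0 then 0
  else ∑ s ∈ Finset.powersetCard m.toNat Finset.univ, ∏ i ∈ s, lam i

noncomputable def esymmDel {n : ℕ} (lam : Fin n → ℝ) (i : Fin n) (m : ℤ) : ℝ :=
  if m < 0 then 0
  else ∑ s ∈ Finset.powersetCard m.toNat (Finset.univ.erase i), ∏ j ∈ s, lam j

noncomputable def esymmDelSet {n : ℕ} (lam : Fin n → ℝ) (S : Finset (Fin n)) (m : ℤ) : ℝ :=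
  if m < 0 then 0
  else ∑ s ∈ Finset.powersetCard m.toNat (Finset.univ \ S), ∏ j ∈ s, lam j

def GardingCone (n k : ℕ) : Set (Fin n → ℝ) :=
  {lam | ∀ m : ℕ, 1 ≤ m → m ≤ k → 0 < esymm lam (m : ℤ)}

noncomputable def sigmaMat {n : ℕ} (A : Matrix (Fin n) (Fin n) ℝ) (m : ℤ) : ℝ :=
  if m < 0 then 0
  else ∑ s ∈ Finset.powersetCard m.toNat (Finset.univ : Finset (Fin n)),
    (A.submatrix (fun i : {x : Fin n // x ∈ s} => (i : Fin n))
                 (fun j : {x : Fin n // x ∈ s} => (j : Fin n))).det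

open Polynomial in
/-- The linear factor `X + r` preserves Newton's inequality for the three lowest coefficients. -/
theorem newton_coeff_of_prod_X_add_C (s : Multiset ℝ) :
    2 * (s.card : ℝ) * ((s.map fun r => X + C r).prod.coeff 0 * (s.map fun r => X + C r).prod.coeff 2)
      ≤ ((s.card : ℝ) - 1) * (s.map fun r => X + C r).prod.coeff 1 ^ 2 := by
  induction s using Multiset.induction with
  | empty => simp [coeff_one]
  | cons r s ih =>
    rcases Multiset.empty_or_exists_mem s with rfl | ⟨x, hx⟩
    · simp [coeff_X, coeff_C]
    have hN : (0 : ℝ) < s.card := by exact_mod_cast Multiset.card_pos_iff_exists_mem.2 ⟨x, hx⟩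
    rw [Multiset.map_cons, Multiset.prod_cons, Multiset.card_cons]
    generalize (s.map fun r => X + C r).prod = p at ih ⊢
    have h0 : ((X + C r) * p).coeff 0 = r * p.coeff 0 := by simp [add_mul]
    have h1 : ((X + C r) * p).coeff 1 = p.coeff 0 + r * p.coeff 1 := by
      simp [add_mul, coeff_X_mul p 0]
    have h2 : ((X + C r) * p).coeff 2 = p.coeff 1 + r * p.coeff 2 := by
      simp [add_mul, coeff_X_mul p 1]
    rw [h0, h1, h2]
    push_cast
    generalize p.coeff 0 = a at *
    generalize p.coeff 1 = b at *
    generalize p.coeff 2 = c at *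
    generalize (s.card : ℝ) = N at *
    refine le_of_mul_le_mul_left ?_ hN
    have := mul_le_mul_of_nonneg_left ih (mul_nonneg (add_nonneg hN.le zero_le_one) (sq_nonneg r))
    nlinarith [sq_nonneg (r * b - N * a)]

open Polynomial in
theorem newton_coeff_of_splits {p : ℝ[X]} (hp : p.Splits) :
    2 * (p.natDegree : ℝ) * (p.coeff 0 * p.coeff 2) ≤ ((p.natDegree : ℝ) - 1) * p.coeff 1 ^ 2 := by
  have h := newton_coeff_of_prod_X_add_C (p.roots.map Neg.neg)
  have hprod : p = C p.leadingCoeff * ((p.roots.map Neg.neg).map fun r => X + C r).prod := by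
    conv_lhs => rw [hp.eq_prod_roots]
    simp [Multiset.map_map, sub_eq_add_neg]
  rw [Multiset.card_map, ← hp.natDegree_eq_card_roots] at h
  have hc (m : ℕ) : p.coeff m =
      p.leadingCoeff * ((p.roots.map Neg.neg).map fun r => X + C r).prod.coeff m := by
    conv_lhs => rw [hprod]
    rw [coeff_C_mul]
  rw [hc 0, hc 1, hc 2]
  nlinarith [mul_le_mul_of_nonneg_left h (sq_nonneg p.leadingCoeff)]

open Polynomial in
/-- By Rolle's theorem the derivative of a real-rooted polynomial is real-rooted. -/
theorem splits_derivative_of_splits {p : ℝ[X]} (hp : p.Splits) : (derivative p).Splits := by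
  rw [splits_iff_card_roots] at hp ⊢
  have h1 := card_roots_le_derivative p
  have h2 := card_roots' (derivative p)
  have h3 := natDegree_derivative p
  omega

open Polynomial in
theorem splits_iterate_derivative_of_splits {p : ℝ[X]} (hp : p.Splits) (m : ℕ) :
    (derivative^[m] p).Splits ∧ (derivative^[m] p).natDegree = p.natDegree - m := by
  induction m with
  | zero => exact ⟨hp, rfl⟩
  | succ m ih =>
    rw [Function.iterate_succ_apply']
    exact ⟨splits_derivative_of_splits ih.1, by rw [natDegree_derivative, ih.2, Nat.sub_sub]⟩

section ElementarySymmetric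

variable {ι : Type*}

/-- The `m`-th elementary symmetric polynomial in the entries of `f` indexed by `S`. -/
def esymmOn (f : ι → ℝ) (S : Finset ι) (m : ℕ) : ℝ :=
  ∑ t ∈ S.powersetCard m, ∏ i ∈ t, f i

theorem esymmOn_zero (f : ι → ℝ) (S : Finset ι) : esymmOn f S 0 = 1 := by
  simp [esymmOn]

theorem esymmOn_eq_zero (f : ι → ℝ) {S : Finset ι} {m : ℕ} (h : #S < m) : esymmOn f S m = 0 := by
  simp [esymmOn, powersetCard_eq_empty.2 h]

open Polynomial in
/-- **Newton's inequality** for the elementary symmetric polynomials of real numbers. -/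
theorem esymmOn_newton (f : ι → ℝ) (S : Finset ι) (j : ℕ) :
    ((j : ℝ) + 2) * ((#S : ℝ) - j) * (esymmOn f S j * esymmOn f S (j + 2))
      ≤ ((j : ℝ) + 1) * ((#S : ℝ) - j - 1) * esymmOn f S (j + 1) ^ 2 := by
  rcases lt_or_ge #S (j + 2) with h | h
  · rw [esymmOn_eq_zero f h]
    rcases lt_or_ge #S (j + 1) with h' | h'
    · simp [esymmOn_eq_zero f h']
    · have : (j : ℝ) + 1 ≤ #S := by exact_mod_cast h'
      rw [mul_zero, mul_zero]
      exact mul_nonneg (mul_nonneg (by positivity) (by linarith)) (sq_nonneg _)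
  · obtain ⟨m, hm⟩ := Nat.exists_eq_add_of_le h
    set p : ℝ[X] := ∏ i ∈ S, (X + C (f i)) with hpdef
    have hp : p.Splits := Splits.prod fun i _ => Splits.X_add_C _
    have hdeg : p.natDegree = #S := by
      rw [hpdef, natDegree_prod_of_monic _ _ fun i _ => monic_X_add_C _]
      simp
    have hcoeff {a b : ℕ} (hab : a + b = #S) : p.coeff a = esymmOn f S b := by
      rw [hpdef, Finset.prod_X_add_C_coeff S f (by omega), show #S - a = b by omega, esymmOn]
    obtain ⟨hs, hd⟩ := splits_iterate_derivative_of_splits hp m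
    have key := newton_coeff_of_splits hs
    rw [hd, hdeg, show #S - m = j + 2 by omega, coeff_iterate_derivative, coeff_iterate_derivative,
      coeff_iterate_derivative, hcoeff (a := 0 + m) (b := j + 2) (by omega),
      hcoeff (a := 1 + m) (b := j + 1) (by omega), hcoeff (a := 2 + m) (b := j) (by omega)] at key
    have d0 : ((0 + m).descFactorial m : ℝ) = m.factorial := by simp [Nat.descFactorial_self]
    have d1 : ((1 + m).descFactorial m : ℝ) = (m + 1) * m.factorial := by
      have := Nat.factorial_mul_descFactorial (Nat.le_add_left m 1)
      rw [Nat.add_sub_cancel, Nat.factorial_one, one_mul, add_comm 1 m, Nat.factorial_succ] at this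
      rw [add_comm 1 m]
      exact_mod_cast this
    have d2 : 2 * ((2 + m).descFactorial m : ℝ) = (m + 2) * ((m + 1) * m.factorial) := by
      have := Nat.factorial_mul_descFactorial (Nat.le_add_left m 2)
      rw [Nat.add_sub_cancel, Nat.factorial_two, add_comm 2 m, Nat.factorial_succ,
        Nat.factorial_succ] at this
      rw [add_comm 2 m]
      exact_mod_cast this
    simp only [nsmul_eq_mul, d0, d1] at key
    have hS : (#S : ℝ) = j + 2 + m := by exact_mod_cast hm
    have hF : (0 : ℝ) < (m + 1) * (m.factorial : ℝ) ^ 2 := by positivity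
    rw [hS]
    refine le_of_mul_le_mul_left ?_ hF
    push_cast at key
    calc _ = ((j : ℝ) + 2) * (m.factorial * esymmOn f S (j + 2) *
          ((m + 2) * ((m + 1) * m.factorial) * esymmOn f S j)) := by ring
      _ ≤ _ := by rw [← d2]; linarith

theorem esymmOn_logConcave (f : ι → ℝ) (S : Finset ι) (j : ℕ) :
    esymmOn f S j * esymmOn f S (j + 2) ≤ esymmOn f S (j + 1) ^ 2 := by
  rcases lt_or_ge #S (j + 2) with h | h
  · rw [esymmOn_eq_zero f h, mul_zero]
    exact sq_nonneg _
  · by_contra! hlt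
    have hn := esymmOn_newton f S j
    have hS : (j : ℝ) + 2 ≤ #S := by exact_mod_cast h
    have hpos := (sq_nonneg _).trans_lt hlt
    nlinarith [mul_le_mul_of_nonneg_left hlt.le
      (mul_nonneg (by positivity : (0 : ℝ) ≤ j + 1) (by linarith : (0 : ℝ) ≤ #S - j - 1)),
      mul_pos (by linarith : (0 : ℝ) < #S + 1) hpos]

/-- Newton–Maclaurin: `σ_k σ_{l-1} / (σ_{k-1} σ_l)` is largest for `k = l`. -/
theorem esymmOn_newton_maclaurin (f : ι → ℝ) (S : Finset ι) {l k : ℕ} (hlk : l ≤ k) (hk : k < #S)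
    (hpos : ∀ m ≤ k, 0 < esymmOn f S m) :
    ((k : ℝ) + 1) * ((#S : ℝ) - l) * (esymmOn f S (k + 1) * esymmOn f S l)
      ≤ ((l : ℝ) + 1) * ((#S : ℝ) - k) * (esymmOn f S k * esymmOn f S (l + 1)) := by
  induction k, hlk using Nat.le_induction with
  | base => rw [mul_comm (esymmOn f S l)]
  | succ k hlk ih =>
    have ih := ih (by omega) fun m hm => hpos m (by omega)
    have hn := esymmOn_newton f S k
    have hkS : (k : ℝ) + 1 < #S := by exact_mod_cast hk
    have hlk' : (l : ℝ) ≤ k := by exact_mod_cast hlk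
    have h0 := hpos k (by omega)
    have h1 := hpos (k + 1) le_rfl
    have hl := hpos l (by omega)
    have e1 := mul_le_mul_of_nonneg_left hn
      (mul_nonneg (by linarith : (0 : ℝ) ≤ #S - l) hl.le)
    have e2 := mul_le_mul_of_nonneg_left ih
      (mul_nonneg (by linarith : (0 : ℝ) ≤ #S - k - 1) h1.le)
    have hc : 0 < ((#S : ℝ) - k) * esymmOn f S k := mul_pos (by linarith) h0
    refine le_of_mul_le_mul_left ?_ hc
    push_cast
    linarith

variable [DecidableEq ι]

theorem esymmOn_succ_erase (f : ι → ℝ) {S : Finset ι} {i : ι} (hi : i ∈ S) (m : ℕ) :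
    esymmOn f S (m + 1) = esymmOn f (S.erase i) (m + 1) + f i * esymmOn f (S.erase i) m := by
  have hi' := notMem_erase i S
  have hsub {t : Finset ι} (ht : t ∈ (S.erase i).powersetCard m) : i ∉ t := fun h =>
    hi' ((mem_powersetCard.1 ht).1 h)
  unfold esymmOn
  conv_lhs => rw [← insert_erase hi]
  rw [← Nat.succ_eq_add_one, powersetCard_succ_insert hi', sum_union, sum_image, mul_sum]
  · congr 1
    exact sum_congr rfl fun t ht => prod_insert (hsub ht)
  · intro s hs t ht hst
    rw [← erase_insert (hsub hs), hst, erase_insert (hsub ht)]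
  · refine disjoint_left.2 fun t ht ht' => ?_
    obtain ⟨u, _, rfl⟩ := mem_image.1 ht'
    exact hi' ((mem_powersetCard.1 ht).1 (mem_insert_self i u))

theorem sum_esymmOn_erase (f : ι → ℝ) (S : Finset ι) (m : ℕ) :
    ∑ i ∈ S, esymmOn f (S.erase i) m = ((#S : ℝ) - m) * esymmOn f S m := by
  unfold esymmOn
  rw [sum_comm' (t' := S.powersetCard m) (s' := fun t => S \ t), mul_sum]
  · refine sum_congr rfl fun t ht => ?_
    obtain ⟨hts, hc⟩ := mem_powersetCard.1 ht
    rw [sum_const, card_sdiff_of_subset hts, nsmul_eq_mul,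
      Nat.cast_sub (card_le_card hts), hc]
  · intro i t
    simp only [mem_powersetCard, mem_sdiff, subset_erase]
    tauto

/-- Deleting an entry maps the Gårding cone `Γ_{k+1}` into `Γ_k`. -/
theorem esymmOn_erase_pos (f : ι → ℝ) {S : Finset ι} {k : ℕ}
    (hpos : ∀ m ≤ k + 1, 0 < esymmOn f S m) {i : ι} (hi : i ∈ S) :
    ∀ m ≤ k, 0 < esymmOn f (S.erase i) m := by
  intro m
  induction m with
  | zero => intro _; rw [esymmOn_zero]; exact one_pos
  | succ m ih =>
    intro hm
    have h0 := ih (by omega)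
    have h1 := hpos (m + 1) (by omega)
    have h2 := hpos (m + 2) (by omega)
    rw [esymmOn_succ_erase f hi] at h1 h2
    have hlc := esymmOn_logConcave f (S.erase i) m
    by_contra! hle
    have e1 := mul_nonneg (neg_nonneg.2 hle) h1.le
    have e2 := mul_pos h0 h2
    nlinarith

/-- If `f i < 0`, successive ratios of the `σ_m(f|i)` are bounded below by `-f i`. -/
theorem esymmOn_erase_ratio (f : ι → ℝ) {S : Finset ι} {k : ℕ}
    (hpos : ∀ m ≤ k + 1, 0 < esymmOn f S m) {i : ι} (hi : i ∈ S) {m : ℕ} (hm : m ≤ k) :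
    -f i * esymmOn f (S.erase i) m ≤ esymmOn f (S.erase i) (m + 1) := by
  have herase := esymmOn_erase_pos f hpos hi
  induction hm using Nat.decreasingInduction with
  | self =>
    have := hpos (k + 1) le_rfl
    rw [esymmOn_succ_erase f hi] at this
    linarith
  | of_succ m hm ih =>
    have h0 := herase m (by omega)
    have h1 := herase (m + 1) (by omega)
    have hlc := esymmOn_logConcave f (S.erase i) m
    refine le_of_mul_le_mul_left ?_ h1
    nlinarith [mul_le_mul_of_nonneg_left ih h0.le]

theorem pow_mul_esymmOn_erase_le (f : ι → ℝ) {S : Finset ι} {k : ℕ}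
    (hpos : ∀ m ≤ k + 1, 0 < esymmOn f S m) {i : ι} (hi : i ∈ S) (hneg : f i < 0) {l d : ℕ}
    (hld : l + d ≤ k) :
    (-f i) ^ d * esymmOn f (S.erase i) l ≤ esymmOn f (S.erase i) (l + d) := by
  induction d with
  | zero => simp
  | succ d ih =>
    calc _ = -f i * ((-f i) ^ d * esymmOn f (S.erase i) l) := by ring
      _ ≤ -f i * esymmOn f (S.erase i) (l + d) :=
        mul_le_mul_of_nonneg_left (ih (by omega)) (by linarith)
      _ ≤ _ := esymmOn_erase_ratio f hpos hi (by omega)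

theorem pow_mul_esymmOn_le (f : ι → ℝ) {S : Finset ι} {k l : ℕ} (hlk : l ≤ k)
    (hpos : ∀ m ≤ k + 1, 0 < esymmOn f S m) {i : ι} (hi : i ∈ S) (hneg : f i < 0) :
    (-f i) ^ (k - l) * esymmOn f S l ≤ ((#S : ℝ) - k) * esymmOn f S k := by
  have hle : esymmOn f S l ≤ esymmOn f (S.erase i) l := by
    cases l with
    | zero => simp [esymmOn_zero]
    | succ l =>
      rw [esymmOn_succ_erase f hi]
      nlinarith [esymmOn_erase_pos f hpos hi l (by omega)]
  calc _ ≤ (-f i) ^ (k - l) * esymmOn f (S.erase i) l :=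
        mul_le_mul_of_nonneg_left hle (pow_nonneg (by linarith) _)
    _ ≤ esymmOn f (S.erase i) k := by
        have := pow_mul_esymmOn_erase_le f hpos hi hneg (l := l) (d := k - l) (by omega)
        rwa [Nat.add_sub_cancel' hlk] at this
    _ ≤ ∑ j ∈ S, esymmOn f (S.erase j) k :=
        single_le_sum (f := fun j => esymmOn f (S.erase j) k)
          (fun j hj => (esymmOn_erase_pos f hpos hj k le_rfl).le) hi
    _ = _ := sum_esymmOn_erase f S k

end ElementarySymmetric

theorem esymm_natCast {n : ℕ} (lam : Fin n → ℝ) (m : ℕ) : esymm lam m = esymmOn lam univ m := by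
  simp [esymm, esymmOn]

theorem esymmDel_natCast {n : ℕ} (lam : Fin n → ℝ) (i : Fin n) (m : ℕ) :
    esymmDel lam i m = esymmOn lam (univ.erase i) m := by
  simp [esymmDel, esymmOn]

theorem esymmDel_neg_one {n : ℕ} (lam : Fin n → ℝ) (i : Fin n) : esymmDel lam i (-1) = 0 := by
  simp [esymmDel]

/-- The derivative sum of `σ_{k+1} / σ_l` is controlled by its first term. -/
theorem sum_deriv_quotient_ge {n k l : ℕ} (hlk : l ≤ k) (hkn : k < n) (lam : Fin n → ℝ)
    (hpos : ∀ m ≤ k + 1, 0 < esymmOn lam univ m) :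
    (((k : ℝ) + 1 - l) / (k + 1)) * (((n : ℝ) - k) * esymmOn lam univ k * esymmOn lam univ l) ≤
      ∑ i : Fin n, (esymmDel lam i (k : ℤ) * esymm lam (l : ℤ)
        - esymm lam ((k + 1 : ℕ) : ℤ) * esymmDel lam i ((l : ℤ) - 1)) := by
  have hk : (0 : ℝ) < k + 1 := by positivity
  rw [sum_sub_distrib, ← sum_mul, ← mul_sum]
  simp only [esymm_natCast, esymmDel_natCast, sum_esymmOn_erase, card_univ, Fintype.card_fin]
  cases l with
  | zero => simp [esymmDel_neg_one, hk.ne']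
  | succ l =>
    have hl : (((l + 1 : ℕ) : ℤ) - 1) = (l : ℤ) := by push_cast; ring
    simp only [hl, esymmDel_natCast, sum_esymmOn_erase, card_univ, Fintype.card_fin]
    have hnm := esymmOn_newton_maclaurin lam univ (l := l) (k := k) (by omega) (by simpa using hkn)
      fun m hm => hpos m (by omega)
    rw [card_univ, Fintype.card_fin] at hnm
    rw [div_mul_eq_mul_div, div_le_iff₀ hk]
    push_cast
    linarith

/-- The eigenvalue estimate (2.13): if 0 ≤ l < k ≤ n, λ ∈ Γ_k with λ₁ ≥ ⋯ ≥ λₙ and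
λₙ < 0, then
Σᵢ [σ_{k−1}(λ|i)σ_l(λ) − σ_k(λ)σ_{l−1}(λ|i)] ≥ ((k−l)/k)·(1/C_n^l)·(−λₙ)^{k−l−1}·σ_l(λ)². -/
theorem sum_deriv_quotient_lower_bound (n k l : ℕ) (hlk : l < k) (hkn : k ≤ n)
    (lam : Fin n → ℝ) (hlam : lam ∈ GardingCone n k)
    (hsort : ∀ i j : Fin n, i ≤ j → lam j ≤ lam i)
    (hneg : lam ⟨n - 1, by omega⟩ < 0) :
    ∑ i : Fin n, (esymmDel lam i ((k : ℤ) - 1) * esymm lam (l : ℤ)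
        - esymm lam (k : ℤ) * esymmDel lam i ((l : ℤ) - 1))
    ≥ (((k : ℝ) - l) / k) * (1 / (n.choose l : ℝ)) *
        (-(lam ⟨n - 1, by omega⟩)) ^ (k - l - 1) * (esymm lam (l : ℤ)) ^ 2 := by
  obtain ⟨k, rfl⟩ := Nat.exists_eq_succ_of_ne_zero (by omega : k ≠ 0)
  rw [Nat.succ_eq_add_one] at *
  have hpos : ∀ m ≤ k + 1, 0 < esymmOn lam univ m := by
    intro m hm
    rcases Nat.eq_zero_or_pos m with rfl | h
    · rw [esymmOn_zero]; exact one_pos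
    · rw [← esymm_natCast]; exact hlam m h hm
  have hle := pow_mul_esymmOn_le lam (l := l) (by omega) hpos (mem_univ ⟨n - 1, by omega⟩) hneg
  rw [card_univ, Fintype.card_fin] at hle
  have hk : ((k + 1 : ℕ) : ℤ) - 1 = (k : ℤ) := by push_cast; ring
  rw [hk, show k + 1 - l - 1 = k - l by omega, ge_iff_le]
  refine le_trans ?_ (sum_deriv_quotient_ge (by omega) (by omega) lam hpos)
  rw [esymm_natCast]
  have hl := hpos l (by omega)
  have hlk' : (l : ℝ) ≤ k := by exact_mod_cast Nat.lt_succ_iff.1 hlk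
  have hchoose : 1 / (n.choose l : ℝ) ≤ 1 := by
    refine div_le_one_of_le₀ ?_ (Nat.cast_nonneg _)
    exact_mod_cast Nat.choose_pos (by omega : l ≤ n)
  have hc : 0 ≤ ((k : ℝ) + 1 - l) / (k + 1) := div_nonneg (by linarith) (by positivity)
  push_cast
  calc _ = (((k : ℝ) + 1 - l) / (k + 1)) * ((1 / (n.choose l : ℝ)) *
        ((-(lam ⟨n - 1, by omega⟩)) ^ (k - l) * esymmOn lam univ l * esymmOn lam univ l)) := by ring
    _ ≤ (((k : ℝ) + 1 - l) / (k + 1)) *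
        ((-(lam ⟨n - 1, by omega⟩)) ^ (k - l) * esymmOn lam univ l * esymmOn lam univ l) := by
        refine mul_le_mul_of_nonneg_left (mul_le_of_le_one_left ?_ hchoose) hc
        exact mul_nonneg (mul_nonneg (pow_nonneg (by linarith) _) hl.le) hl.le
    _ ≤ _ := mul_le_mul_of_nonneg_left (mul_le_mul_of_nonneg_right hle hl.le) hc
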